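/- Let X, Y be nonempty sets and let d, ρ be discrete pseudometrics on X and Y respectively. Then for every bijection g : Y → X the following statements are equivalent: (1) g is a similarity of (Y,ρ) and (X,d); (2) g is a weak similarity of (Y,ρ) and (X,d); (3) g is a combinatorial similarity of (Y,ρ) and (X,d); (4) the equivalence (ρ(x,y) = 0) ⇔ (d(g(x), g(y)) = 0) is valid for all x, y ∈ Y. -/

import Mathlib

open Set

universe u v w z

def range2 {X : Type u} {A : Type w} (Φ : X → X → A) : Set A := {a | ∃ x y, Φ x y = a}

def fiber {X : Type u} {A : Type w} (Φ : X → X → A) (a : A) : Set (X × X) :=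
  {p | Φ p.1 p.2 = a}

def fibers {X : Type u} {A : Type w} (Φ : X → X → A) : Set (Set (X × X)) :=
  {R | ∃ a ∈ range2 Φ, R = fiber Φ a}

def IsCoherent {X : Type u} {A : Type w} (Φ : X → X → A) (a₀ : A) : Prop :=
  Equivalence (fun x y => Φ x y = a₀) ∧
    ∀ x₁ x₂ x₃ x₄, Φ x₁ x₂ = a₀ → Φ x₃ x₄ = a₀ → Φ x₁ x₃ = Φ x₂ x₄

def CombSim {X : Type u} {Y : Type v} {A : Type w} {B : Type z}
    (Φ : X → X → A) (Ψ : Y → Y → B) : Prop :=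
  ∃ (g : Y → X) (f : A → B), Function.Bijective g ∧
    Set.BijOn f (range2 Φ) (range2 Ψ) ∧ ∀ x y, Ψ x y = f (Φ (g x) (g y))

def IsPseudometric {X : Type u} (d : X → X → ℝ) : Prop :=
  (∀ x y, 0 ≤ d x y) ∧ (∀ x y, d x y = d y x) ∧ (∀ x, d x x = 0) ∧
    ∀ x y z, d x y ≤ d x z + d z y

def IsDiscretePseudometric {X : Type u} (d : X → X → ℝ) : Prop :=
  IsPseudometric d ∧ Cardinal.mk (range2 d) ≤ 2

/-- A discrete pseudometric takes at most one nonzero value. -/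
theorem IsDiscretePseudometric.eq_of_ne_zero {X : Type u} {d : X → X → ℝ}
    (hd : IsDiscretePseudometric d) {x y z w : X} (hxy : d x y ≠ 0) (hzw : d z w ≠ 0) :
    d x y = d z w := by
  by_contra hne
  have hsub : (({0, d x y, d z w} : Finset ℝ) : Set ℝ) ⊆ range2 d := by
    intro a ha
    simp only [Finset.coe_insert, Finset.coe_singleton, mem_insert_iff, mem_singleton_iff] at ha
    rcases ha with rfl | rfl | rfl
    exacts [⟨x, x, hd.1.2.2.1 x⟩, ⟨x, y, rfl⟩, ⟨z, w, rfl⟩]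
  have hcard : ({0, d x y, d z w} : Finset ℝ).card = 3 :=
    Finset.card_eq_three.2 ⟨_, _, _, hxy.symm, hzw.symm, hne, rfl⟩
  have hle := (Cardinal.mk_le_mk_of_subset hsub).trans hd.2
  rw [Finset.coe_sort_coe, Cardinal.mk_coe_finset, hcard] at hle
  norm_num at hle

/-- Proposition 3.5: for discrete pseudometrics `d` on `X` and `ρ` on `Y` and a bijection
`g : Y → X`, the following are equivalent: (1) `g` is a similarity; (2) `g` is a weak
similarity; (3) `g` is a combinatorial similarity; (4) `ρ(x,y) = 0 ⇔ d(g x, g y) = 0`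
for all `x, y ∈ Y`. -/
theorem discrete_similarity_tfae {X : Type u} {Y : Type v} [Nonempty X] [Nonempty Y]
    (d : X → X → ℝ) (ρ : Y → Y → ℝ)
    (hd : IsDiscretePseudometric d) (hρ : IsDiscretePseudometric ρ)
    (g : Y → X) (hg : Function.Bijective g) :
    List.TFAE
      [∃ r : ℝ, 0 < r ∧ ∀ x y, d (g x) (g y) = r * ρ x y,
       ∃ f : ℝ → ℝ, StrictMonoOn f (range2 d) ∧ Set.MapsTo f (range2 d) (range2 ρ) ∧
         ∀ x y, ρ x y = f (d (g x) (g y)),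
       ∃ f : ℝ → ℝ, Set.BijOn f (range2 d) (range2 ρ) ∧ ∀ x y, ρ x y = f (d (g x) (g y)),
       ∀ x y, ρ x y = 0 ↔ d (g x) (g y) = 0] := by
  tfae_have 1 → 2 := by
    rintro ⟨r, hr, h⟩
    have key : ∀ x y, ρ x y = r⁻¹ * d (g x) (g y) := fun x y => by
      rw [h, inv_mul_cancel_left₀ hr.ne']
    refine ⟨fun a => r⁻¹ * a, ?_, ?_, key⟩
    · intro a _ b _ hab
      exact mul_lt_mul_of_pos_left hab (inv_pos.2 hr)
    · rintro _ ⟨x, y, rfl⟩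
      obtain ⟨x, rfl⟩ := hg.surjective x
      obtain ⟨y, rfl⟩ := hg.surjective y
      exact ⟨x, y, key x y⟩
  tfae_have 2 → 3 := by
    rintro ⟨f, hmono, hmaps, h⟩
    refine ⟨f, ⟨hmaps, hmono.injOn, ?_⟩, h⟩
    rintro _ ⟨x, y, rfl⟩
    exact ⟨_, ⟨g x, g y, rfl⟩, (h x y).symm⟩
  tfae_have 3 → 4 := by
    rintro ⟨f, hf, h⟩ x y
    have hd0 : d (g x) (g x) = 0 := hd.1.2.2.1 _
    have hf0 : f 0 = 0 := (congrArg f hd0).symm.trans ((h x x).symm.trans (hρ.1.2.2.1 x))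
    rw [h]
    refine ⟨fun hxy => ?_, fun hxy => by rw [hxy, hf0]⟩
    exact hf.injOn ⟨_, _, rfl⟩ ⟨_, _, hd0⟩ (hxy.trans hf0.symm)
  tfae_have 4 → 1 := by
    intro h
    by_cases hne : ∃ x y, ρ x y ≠ 0
    · obtain ⟨x₀, y₀, hρ₀⟩ := hne
      have hd₀ : d (g x₀) (g y₀) ≠ 0 := fun h0 => hρ₀ ((h _ _).2 h0)
      refine ⟨d (g x₀) (g y₀) / ρ x₀ y₀, div_pos ((hd.1.1 _ _).lt_of_ne' hd₀)
        ((hρ.1.1 _ _).lt_of_ne' hρ₀), fun x y => ?_⟩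
      by_cases hxy : ρ x y = 0
      · rw [(h x y).1 hxy, hxy, mul_zero]
      · rw [hρ.eq_of_ne_zero hxy hρ₀, div_mul_cancel₀ _ hρ₀]
        exact hd.eq_of_ne_zero (fun h0 => hxy ((h x y).2 h0)) hd₀
    · push Not at hne
      exact ⟨1, one_pos, fun x y => by rw [(h x y).1 (hne x y), hne, mul_zero]⟩
  tfae_finish
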